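/- arXiv:2302.03999 — 3 statements merged into one kernel-verified Lean document; each statement's English description precedes it below -/
import Mathlib

section
/- Let R be a commutative ring containing the rationals, let φ = (φ_n)_{n≥0} and ψ = (ψ_n)_{n≥0} be sequences in R, set ψ'_n := (n+1)·ψ_{n+1}, a_n := Σ_{i=0}^n φ_i·ψ_{n−i}, z_n := Σ_{i=0}^n φ_i·ψ'_{n−i}, and let ξ ∈ R. Then EAZ(a, z + ξa) = M(φ)·(Δ + ξI)·M(ψ), where z + ξa denotes the sequence (z_n + ξ·a_n)_{n≥0}, M(c) is the lower-triangular matrix with entries M(c)_{ni} = (n!/i!)·c_{n−i} for i ≤ n and 0 otherwise, Δ is the matrix with Δ_{ij} = 1 if j = i+1 and 0 otherwise, I is the identity matrix, and the matrix products are well-defined since every entry of the product is a finite sum. -/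
/-- The exponential AZ matrix `EAZ(a,z)`: lower-Hessenberg, with entries
`(n!/k!)·(z_{n-k} + k·a_{n-k+1})` for `0 ≤ k ≤ n`, `a_0` on the superdiagonal
`k = n+1` (which is the value of the formula there, `z_{-1}` being `0`), and
`0` for `k > n+1`. -/
noncomputable def EAZ {R : Type*} [CommRing R] [Algebra ℚ R]
    (a z : ℕ → R) (n k : ℕ) : R :=
  if k ≤ n then
    ((n.factorial : ℚ) / (k.factorial : ℚ)) • (z (n - k) + (k : R) * a (n - k + 1))
  else if k = n + 1 then a 0
  else 0

/-- The lower-triangular matrix `M(c)` with entries `M(c)_{ni} = (n!/i!)·c_{n-i}`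
for `i ≤ n` and `0` otherwise. -/
noncomputable def lowerFactMat {R : Type*} [CommRing R] [Algebra ℚ R]
    (c : ℕ → R) (n i : ℕ) : R :=
  if i ≤ n then ((n.factorial : ℚ) / (i.factorial : ℚ)) • c (n - i) else 0

/-- Product of infinite matrices: entry `(i,k)` is the (finitely supported)
sum `Σ_j A_{ij}·B_{jk}`. -/
noncomputable def imul {R : Type*} [CommRing R] (A B : ℕ → ℕ → R) : ℕ → ℕ → R :=
  fun i k => ∑ᶠ j : ℕ, A i j * B j k

open Finset in
/-- A convolution against a sequence shifted by `k` is the convolution at index `n - k`. -/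
theorem sum_mul_shift {R : Type*} [CommRing R] (φ g : ℕ → R) (n k : ℕ) :
    ∑ i ∈ range (n + 1), φ i * (if k ≤ n - i then g (n - i - k) else 0)
      = if k ≤ n then ∑ i ∈ range (n - k + 1), φ i * g (n - k - i) else 0 := by
  split_ifs with h
  · rw [← sum_subset (s₁ := range (n - k + 1))]
    · refine sum_congr rfl fun i hi => ?_
      rw [mem_range] at hi
      rw [if_pos (by omega), Nat.sub_right_comm]
    · intro i hi
      rw [mem_range] at *
      omega
    · intro i hi hi'
      rw [mem_range] at *
      rw [if_neg (by omega), mul_zero]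
  · refine sum_eq_zero fun i _ => ?_
    rw [if_neg (by omega), mul_zero]

/-- Left multiplication by `Δ + ξI` adds `ξ` times each row to the next row. -/
theorem imul_shift_add_diagonal {R : Type*} [CommRing R] (ξ : R) (B : ℕ → ℕ → R) (i k : ℕ) :
    imul (fun i j => (if j = i + 1 then (1 : R) else 0) + (if i = j then ξ else 0)) B i k
      = B (i + 1) k + ξ * B i k := by
  unfold imul
  rw [finsum_eq_sum_of_support_subset (s := {i + 1, i})]
  · rw [Finset.sum_pair (by omega)]
    simp
  · intro j hj
    by_contra h
    simp only [Finset.coe_insert, Finset.coe_singleton, Set.mem_insert_iff,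
      Set.mem_singleton_iff, not_or] at h
    exact hj (by simp [h.1, Ne.symm h.2])

/-- Left multiplication by the lower-triangular `lowerFactMat φ` as a sum over `i ≤ n`. -/
theorem imul_lowerFactMat {R : Type*} [CommRing R] [Algebra ℚ R]
    (φ : ℕ → R) (B : ℕ → ℕ → R) (n k : ℕ) :
    imul (lowerFactMat φ) B n k
      = ∑ i ∈ Finset.range (n + 1),
          ((n.factorial : ℚ) / ((n - i).factorial : ℚ)) • φ i * B (n - i) k := by
  unfold imul
  rw [finsum_eq_sum_of_support_subset (s := Finset.range (n + 1)), ← Finset.sum_range_reflect]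
  · refine Finset.sum_congr rfl fun i hi => ?_
    rw [Finset.mem_range] at hi
    have h : n + 1 - 1 - i = n - i := by omega
    rw [h, lowerFactMat, if_pos (Nat.sub_le n i), Nat.sub_sub_self (by omega)]
  · intro j hj
    by_contra h
    refine hj ?_
    simp only [Finset.coe_range, Set.mem_Iio] at h
    simp [lowerFactMat, show ¬ j ≤ n by omega]

theorem factorial_smul_mul_lowerFactMat {R : Type*} [CommRing R] [Algebra ℚ R]
    (ψ : ℕ → R) (x : R) (n j k : ℕ) :
    ((n.factorial : ℚ) / (j.factorial : ℚ)) • x * lowerFactMat ψ j k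
      = ((n.factorial : ℚ) / (k.factorial : ℚ)) • (x * if k ≤ j then ψ (j - k) else 0) := by
  unfold lowerFactMat
  split_ifs
  · rw [smul_mul_smul_comm, div_mul_div_cancel₀ (by positivity)]
  · simp

theorem factorial_smul_mul_lowerFactMat_succ {R : Type*} [CommRing R] [Algebra ℚ R]
    (ψ : ℕ → R) (x : R) (n j k : ℕ) :
    ((n.factorial : ℚ) / (j.factorial : ℚ)) • x * lowerFactMat ψ (j + 1) k
      = ((n.factorial : ℚ) / (k.factorial : ℚ)) •
          (x * (if k ≤ j then ((j - k + 1 : ℕ) : R) * ψ (j - k + 1) else 0)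
            + k * (x * if k - 1 ≤ j then ψ (j + 1 - k) else 0)) := by
  have h : ((n.factorial : ℚ) / (j.factorial : ℚ)) • x
      = ((n.factorial : ℚ) / ((j + 1).factorial : ℚ)) • (((j + 1 : ℕ) : R) * x) := by
    rw [← nsmul_eq_mul, ← Nat.cast_smul_eq_nsmul ℚ, smul_smul, Nat.factorial_succ]
    congr 1
    push_cast
    field_simp
  rw [h, factorial_smul_mul_lowerFactMat]
  congr 1
  by_cases h₁ : k ≤ j
  · obtain ⟨m, rfl⟩ := Nat.exists_eq_add_of_le h₁
    rw [if_pos (by omega), if_pos h₁, if_pos (by omega),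
      show k + m + 1 - k = m + 1 by omega, show k + m - k = m by omega]
    push_cast
    ring
  · by_cases h₂ : k = j + 1
    · subst h₂
      simp
      ring
    · simp [h₁, show ¬ k ≤ j + 1 by omega, show ¬ k - 1 ≤ j by omega]

/-- let `R` be a commutative ring containing the rationals,
`φ, ψ` sequences in `R`, `ψ'_n := (n+1)·ψ_{n+1}`,
`a_n := Σ_{i≤n} φ_i·ψ_{n-i}`, `z_n := Σ_{i≤n} φ_i·ψ'_{n-i}`, `ξ ∈ R`.  Then
`EAZ(a, z + ξa) = M(φ)·(Δ + ξI)·M(ψ)`, where `Δ` has `1` on the superdiagonal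
and `0` elsewhere and `I` is the identity. -/
theorem EAZ_factorization {R : Type*} [CommRing R] [Algebra ℚ R]
    (φ ψ : ℕ → R) (ξ : R) :
    EAZ (fun n => ∑ i ∈ Finset.range (n + 1), φ i * ψ (n - i))
        (fun n =>
          (∑ i ∈ Finset.range (n + 1),
              φ i * (((n - i + 1 : ℕ) : R) * ψ (n - i + 1)))
            + ξ * ∑ i ∈ Finset.range (n + 1), φ i * ψ (n - i))
      = imul (lowerFactMat φ)
          (imul
            (fun i j => (if j = i + 1 then (1 : R) else 0)
              + (if i = j then ξ else 0))
            (lowerFactMat ψ)) := by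
  funext n k
  have h (i : ℕ) :
      ((n.factorial : ℚ) / ((n - i).factorial : ℚ)) • φ i *
          (lowerFactMat ψ (n - i + 1) k + ξ * lowerFactMat ψ (n - i) k)
        = ((n.factorial : ℚ) / (k.factorial : ℚ)) •
          (φ i * (if k ≤ n - i then ((n - i - k + 1 : ℕ) : R) * ψ (n - i - k + 1) else 0)
            + k * (φ i * if k - 1 ≤ n - i then ψ (n - i + 1 - k) else 0)
            + ξ * (φ i * if k ≤ n - i then ψ (n - i - k) else 0)) := by
    rw [mul_add, mul_left_comm, factorial_smul_mul_lowerFactMat,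
      factorial_smul_mul_lowerFactMat_succ, mul_smul_comm, ← smul_add]
  simp only [imul_lowerFactMat, imul_shift_add_diagonal, h]
  rw [← Finset.smul_sum, Finset.sum_add_distrib, Finset.sum_add_distrib, ← Finset.mul_sum,
    ← Finset.mul_sum, sum_mul_shift φ (fun m => ((m + 1 : ℕ) : R) * ψ (m + 1)),
    sum_mul_shift φ ψ]
  unfold EAZ
  rcases k with _ | k
  · simp
  · simp only [Nat.add_sub_add_right, Nat.add_sub_cancel]
    rw [sum_mul_shift φ ψ]
    split_ifs with h₁ h₂ h₃ h₄ h₅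
    all_goals try omega
    · rw [show n - (k + 1) + 1 = n - k by omega]
      congr 1
      ring
    · obtain rfl : k = n := by omega
      simp only [zero_add, mul_zero, add_zero, Nat.sub_self, Finset.sum_range_one]
      rw [← nsmul_eq_mul, ← Nat.cast_smul_eq_nsmul ℚ, smul_smul, Nat.factorial_succ]
      have : (k.factorial : ℚ) / (((k + 1) * k.factorial : ℕ) : ℚ) * ((k + 1 : ℕ) : ℚ) = 1 := by
        push_cast
        field_simp
      rw [this, one_smul]
    · simp
end

section
/- Let R be a commutative ring containing the rationals, let a = (a_n)_{n≥0} and z = (z_n)_{n≥0} be sequences in R, and let ξ ∈ R. Then EAZ(a,z)·B_ξ = B_ξ·EAZ(a, z + ξa), where z + ξa denotes the sequence (z_n + ξ·a_n)_{n≥0}, and both matrix products are well-defined since every entry is a finite sum (B_ξ is lower-triangular and EAZ matrices are lower-Hessenberg). Equivalently, B_ξ^{-1}·EAZ(a,z)·B_ξ = EAZ(a, z + ξa). -/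
/-- The weighted binomial matrix `B_ξ` with entries `C(i,j)·ξ^{i-j}` for
`j ≤ i` and `0` otherwise. -/
def binomialMat {R : Type*} [CommRing R] (ξ : R) (i j : ℕ) : R :=
  if j ≤ i then (i.choose j : R) * ξ ^ (i - j) else 0

open PowerSeries in
/-- The exponential generating function `∑ v_n t^n / n!` of a sequence. -/
noncomputable def expGenFun {R : Type*} [CommRing R] [Algebra ℚ R] (v : ℕ → R) : R⟦X⟧ :=
  PowerSeries.mk fun n => algebraMap ℚ R (n.factorial : ℚ)⁻¹ * v n

section ExpGenFun

open Finset PowerSeries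

variable {R : Type*} [CommRing R] [Algebra ℚ R]

theorem factorial_mul_algebraMap_inv (n : ℕ) :
    (n.factorial : R) * algebraMap ℚ R (n.factorial : ℚ)⁻¹ = 1 := by
  have h : (n.factorial : ℚ) ≠ 0 := by exact_mod_cast n.factorial_ne_zero
  rw [← map_natCast (algebraMap ℚ R), ← map_mul, mul_inv_cancel₀ h, map_one]

theorem algebraMap_inv_factorial_succ_mul (n : ℕ) :
    algebraMap ℚ R ((n + 1).factorial : ℚ)⁻¹ * ((n : R) + 1)
      = algebraMap ℚ R (n.factorial : ℚ)⁻¹ := by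
  have h : (n.factorial : ℚ) ≠ 0 := by exact_mod_cast n.factorial_ne_zero
  have h' : (n : ℚ) + 1 ≠ 0 := by positivity
  have e : (n : R) + 1 = algebraMap ℚ R ((n : ℚ) + 1) := by simp
  rw [e, ← map_mul, Nat.factorial_succ]
  refine congrArg _ ?_
  push_cast
  field_simp

theorem choose_eq_factorial_mul_algebraMap {n j : ℕ} (h : j ≤ n) :
    (n.choose j : R) = n.factorial * (algebraMap ℚ R ((n - j).factorial : ℚ)⁻¹
      * algebraMap ℚ R (j.factorial : ℚ)⁻¹) := by
  rw [← map_natCast (algebraMap ℚ R), ← map_natCast (algebraMap ℚ R), ← map_mul, ← map_mul,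
    Nat.cast_choose ℚ h]
  congr 1
  rw [div_eq_mul_inv, mul_inv]
  ring

theorem derivative_expGenFun (v : ℕ → R) :
    derivative R (expGenFun v) = expGenFun fun n => v (n + 1) := by
  ext n
  simp only [coeff_derivative, expGenFun, coeff_mk]
  rw [← algebraMap_inv_factorial_succ_mul n]
  ring

theorem expGenFun_factorial_mul_coeff (f : R⟦X⟧) :
    (expGenFun fun n => (n.factorial : R) * coeff n f) = f := by
  ext n
  rw [expGenFun, coeff_mk]
  linear_combination coeff n f * factorial_mul_algebraMap_inv (R := R) n

theorem finsum_EAZ_mul (a z v : ℕ → R) (n : ℕ) :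
    ∑ᶠ j, EAZ a z n j * v j = n.factorial *
      coeff n (PowerSeries.mk z * expGenFun v
        + PowerSeries.mk a * derivative R (expGenFun v)) := by
  have hs : (Function.support fun j => EAZ a z n j * v j) ⊆ (range (n + 2) : Finset ℕ) := by
    intro j hj
    by_contra hlt
    simp only [coe_range, Set.mem_Iio, not_lt] at hlt
    exact hj (by simp [EAZ, show ¬ j ≤ n by omega, show j ≠ n + 1 by omega])
  have hterm : ∀ j ∈ range (n + 2), EAZ a z n j * v j =
      (if j ≤ n then n.factorial * (z (n - j) * (algebraMap ℚ R (j.factorial : ℚ)⁻¹ * v j)) else 0)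
        + n.factorial * (a (n + 1 - j) * (algebraMap ℚ R (j.factorial : ℚ)⁻¹ * j * v j)) := by
    intro j hj
    rw [mem_range] at hj
    by_cases h : j ≤ n
    · rw [EAZ, if_pos h, if_pos h, Algebra.smul_def, div_eq_mul_inv, map_mul, map_natCast,
        Nat.sub_add_comm h]
      ring
    · obtain rfl : j = n + 1 := by omega
      have h₁ := factorial_mul_algebraMap_inv (R := R) n
      have h₂ := algebraMap_inv_factorial_succ_mul (R := R) n
      simp only [EAZ, if_neg h, if_true, Nat.sub_self, Nat.cast_succ, h₂]
      linear_combination -(a 0 * v (n + 1)) * h₁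
  rw [finsum_eq_sum_of_support_subset _ hs, sum_congr rfl hterm, sum_add_distrib,
    derivative_expGenFun, map_add, mul_add]
  congr 1
  · rw [sum_range_succ, if_neg (by omega), add_zero, mul_comm (PowerSeries.mk z), coeff_mul,
      Nat.sum_antidiagonal_eq_sum_range_succ_mk, mul_sum]
    refine sum_congr rfl fun j hj => ?_
    rw [if_pos (by simpa [Nat.lt_succ_iff] using hj), expGenFun, coeff_mk, coeff_mk]
    ring
  · rw [sum_range_succ', mul_comm (PowerSeries.mk a), coeff_mul,
      Nat.sum_antidiagonal_eq_sum_range_succ_mk, mul_sum]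
    simp only [Nat.cast_zero, mul_zero, zero_mul, add_zero, Nat.cast_succ,
      algebraMap_inv_factorial_succ_mul, Nat.add_sub_add_right]
    refine sum_congr rfl fun j _ => ?_
    rw [expGenFun, coeff_mk, coeff_mk]
    ring

theorem finsum_binomialMat_mul (ξ : R) (v : ℕ → R) (n : ℕ) :
    ∑ᶠ j, binomialMat ξ n j * v j = n.factorial *
      coeff n (expGenFun (fun m => ξ ^ m) * expGenFun v) := by
  have hs : (Function.support fun j => binomialMat ξ n j * v j) ⊆ (range (n + 1) : Finset ℕ) := by
    intro j hj
    by_contra hlt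
    simp only [coe_range, Set.mem_Iio, not_lt] at hlt
    exact hj (by simp [binomialMat, show ¬ j ≤ n by omega])
  rw [finsum_eq_sum_of_support_subset _ hs, mul_comm (expGenFun _), coeff_mul,
    Nat.sum_antidiagonal_eq_sum_range_succ_mk, mul_sum]
  refine sum_congr rfl fun j hj => ?_
  have h : j ≤ n := by simpa [Nat.lt_succ_iff] using hj
  rw [binomialMat, if_pos h, choose_eq_factorial_mul_algebraMap h]
  simp only [expGenFun, coeff_mk]
  ring

theorem finsum_mul_single {S : Type*} [CommRing S] (f : ℕ → S) (k : ℕ) :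
    ∑ᶠ j, f j * (Pi.single k 1 : ℕ → S) j = f k := by
  rw [finsum_eq_single _ k fun j hj => by simp [hj]]
  simp

theorem expGenFun_EAZ_column (a z : ℕ → R) (k : ℕ) :
    (expGenFun fun n => EAZ a z n k) = PowerSeries.mk z * expGenFun (Pi.single k 1)
      + PowerSeries.mk a * derivative R (expGenFun (Pi.single k 1)) := by
  simp_rw [← finsum_mul_single (EAZ a z _) k, finsum_EAZ_mul, expGenFun_factorial_mul_coeff]

theorem expGenFun_binomialMat_column (ξ : R) (k : ℕ) :
    (expGenFun fun n => binomialMat ξ n k)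
      = expGenFun (fun m => ξ ^ m) * expGenFun (Pi.single k 1) := by
  simp_rw [← finsum_mul_single (binomialMat ξ _) k, finsum_binomialMat_mul,
    expGenFun_factorial_mul_coeff]

theorem derivative_expGenFun_pow (ξ : R) :
    derivative R (expGenFun fun m => ξ ^ m) = C ξ * expGenFun fun m => ξ ^ m := by
  rw [derivative_expGenFun]
  ext n
  simp only [expGenFun, coeff_C_mul, coeff_mk]
  ring

end ExpGenFun

/-- let `R` be a commutative ring containing the rationals,
`a, z` sequences in `R`, and `ξ ∈ R`.  Then
`EAZ(a,z)·B_ξ = B_ξ·EAZ(a, z + ξa)` (equivalently,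
`B_ξ⁻¹·EAZ(a,z)·B_ξ = EAZ(a, z + ξa)`); all the matrix products are
(finitely supported) well-defined sums. -/
theorem EAZ_binomial_conjugation {R : Type*} [CommRing R] [Algebra ℚ R]
    (a z : ℕ → R) (ξ : R) :
    imul (EAZ a z) (binomialMat ξ)
      = imul (binomialMat ξ) (EAZ a (fun n => z n + ξ * a n)) := by
  funext n k
  have hmk : (PowerSeries.mk fun n => z n + ξ * a n)
      = PowerSeries.mk z + PowerSeries.C ξ * PowerSeries.mk a := by
    ext m
    simp
  simp only [imul]
  rw [finsum_EAZ_mul a z fun j => binomialMat ξ j k,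
    finsum_binomialMat_mul ξ fun j => EAZ a (fun n => z n + ξ * a n) j k,
    expGenFun_binomialMat_column, expGenFun_EAZ_column, hmk, Derivation.leibniz,
    derivative_expGenFun_pow, smul_eq_mul, smul_eq_mul]
  congr 2
  ring
end

section
/- Define S_m = Σ_{i=0}^m m!/i! (the ordered subset numbers) and the lower-Hessenberg matrix P with entries p_{n,k} = n·binom(n,k)·S_{n−k} + binom(n+1,k) for 0 ≤ k ≤ n+1 and p_{n,k} = 0 for k > n+1. Then P is the production matrix of the matrix T = (binom(n,k)·n^{n−k})_{n,k≥0} (with 0^0 = 1): for all n ≥ 0 and all k ≥ 0, binom(n+1,k)·(n+1)^{n+1−k} = Σ_{j=0}^{n} binom(n,j)·n^{n−j}·p_{j,k}, where the left-hand side is interpreted as 0 for k > n+1. Moreover p_{n,0} = p_{n,1} = n·S_n + 1 for all n ≥ 0. -/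
/-- The ordered subset numbers `S_m = Σ_{i=0}^m m!/i!` (the divisions are
exact). -/
def orderedSubsetNum (m : ℕ) : ℕ :=
  ∑ i ∈ Finset.range (m + 1), m.factorial / i.factorial

/-- The lower-Hessenberg matrix `P` with entries
`p_{n,k} = n·C(n,k)·S_{n-k} + C(n+1,k)` for `0 ≤ k ≤ n+1` and `p_{n,k} = 0`
for `k > n+1`. -/
def prodEntry (n k : ℕ) : ℕ :=
  if k ≤ n + 1 then n * n.choose k * orderedSubsetNum (n - k) + (n + 1).choose k
  else 0

/-- The tree matrix `T` with entries `t_{n,k} = C(n,k)·n^{n-k}` for `k ≤ n`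
(with `0^0 = 1`) and `0` for `k > n`. -/
def treeEntry (n k : ℕ) : ℕ :=
  if k ≤ n then n.choose k * n ^ (n - k) else 0

open Finset in
/-- The trinomial sum `Σ_j C(n,j) C(j,k) a^(n-j) = C(n,k) (a+1)^(n-k)`. -/
theorem sum_choose_mul_pow_mul_choose (a n k : ℕ) :
    ∑ j ∈ range (n + 1), n.choose j * a ^ (n - j) * j.choose k =
      n.choose k * (a + 1) ^ (n - k) := by
  rcases lt_or_ge n k with hk | hk
  · rw [Nat.choose_eq_zero_of_lt hk, zero_mul]
    refine sum_eq_zero fun j hj => ?_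
    rw [Nat.choose_eq_zero_of_lt (by grind : j < k), mul_zero]
  obtain ⟨m, rfl⟩ := Nat.exists_eq_add_of_le hk
  rw [add_assoc, sum_range_add, sum_eq_zero, zero_add, Nat.add_sub_cancel_left,
    add_comm a 1, add_pow, mul_sum]
  · refine sum_congr rfl fun i hi => ?_
    have h := Nat.choose_mul (n := k + m) (k := k + i) (s := k) (by omega)
    simp only [Nat.add_sub_cancel_left] at h
    rw [Nat.add_sub_add_left, mul_right_comm, h, one_pow, Nat.cast_id]
    ring
  · intro j hj
    rw [Nat.choose_eq_zero_of_lt (mem_range.mp hj), mul_zero]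

open Finset in
/-- Partial-sum form of `sum_choose_mul_pow_mul_of_recurrence`. -/
theorem sum_choose_mul_pow_mul_partial {q c : ℕ → ℕ} (h0 : q 0 = c 0)
    (hq : ∀ j, q (j + 1) = (j + 1) * q j + c (j + 1)) {n m : ℕ} (hm : m ≤ n) :
    ∑ j ∈ range (m + 1), n.choose j * n ^ (n - j) * (j * q j) +
        (n - m) * (n.choose m * n ^ (n - m) * q m) =
      n * ∑ j ∈ range (m + 1), n.choose j * n ^ (n - j) * c j := by
  induction m with
  | zero => simp [h0]
  | succ m ih =>
    have ih := ih (by omega)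
    rw [sum_range_succ, sum_range_succ _ (m + 1), mul_add, ← ih, hq]
    obtain ⟨d, rfl⟩ := Nat.exists_eq_add_of_le hm
    have hc := Nat.choose_succ_right_eq (m + 1 + d) m
    have e1 : m + 1 + d - m = d + 1 := by omega
    rw [e1] at hc ⊢
    rw [Nat.add_sub_cancel_left, pow_succ]
    linear_combination ((m + 1 + d) ^ d * (m + 1 + d) * q m) * hc

/-- A solution of `q_{j+1} = (j+1) q_j + c_{j+1}`, `q_0 = c_0` satisfies
`Σ_j C(n,j) n^(n-j) j q_j = n Σ_j C(n,j) n^(n-j) c_j`. -/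
theorem sum_choose_mul_pow_mul_of_recurrence {q c : ℕ → ℕ} (h0 : q 0 = c 0)
    (hq : ∀ j, q (j + 1) = (j + 1) * q j + c (j + 1)) (n : ℕ) :
    ∑ j ∈ Finset.range (n + 1), n.choose j * n ^ (n - j) * (j * q j) =
      n * ∑ j ∈ Finset.range (n + 1), n.choose j * n ^ (n - j) * c j := by
  simpa using sum_choose_mul_pow_mul_partial h0 hq le_rfl

theorem orderedSubsetNum_zero : orderedSubsetNum 0 = 1 := by
  simp [orderedSubsetNum]

theorem orderedSubsetNum_succ (m : ℕ) :
    orderedSubsetNum (m + 1) = (m + 1) * orderedSubsetNum m + 1 := by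
  rw [orderedSubsetNum, Finset.sum_range_succ, Nat.div_self (Nat.factorial_pos _),
    orderedSubsetNum, Finset.mul_sum]
  congr 1
  refine Finset.sum_congr rfl fun i hi => ?_
  rw [Nat.factorial_succ, Nat.mul_div_assoc _ (Nat.factorial_dvd_factorial (by grind))]

theorem choose_mul_orderedSubsetNum_succ (k j : ℕ) :
    (j + 1).choose k * orderedSubsetNum (j + 1 - k) =
      (j + 1) * (j.choose k * orderedSubsetNum (j - k)) + (j + 1).choose k := by
  rcases lt_or_ge j k with hk | hk
  · rw [Nat.choose_eq_zero_of_lt hk, Nat.sub_eq_zero_of_le hk, orderedSubsetNum_zero]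
    simp
  · have h := Nat.choose_mul_succ_eq j k
    rw [Nat.succ_sub hk, Nat.succ_eq_add_one] at h ⊢
    rw [orderedSubsetNum_succ]
    linear_combination orderedSubsetNum (j - k) * h.symm

theorem prodEntry_eq (n k : ℕ) :
    prodEntry n k =
      n * (n.choose k * orderedSubsetNum (n - k)) + (n + 1).choose k := by
  unfold prodEntry
  split_ifs with h
  · ring
  · simp [Nat.choose_eq_zero_of_lt (by omega : n < k),
      Nat.choose_eq_zero_of_lt (by omega : n + 1 < k)]

theorem treeEntry_eq (n k : ℕ) : treeEntry n k = n.choose k * n ^ (n - k) := by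
  unfold treeEntry
  split_ifs with h
  · rfl
  · rw [Nat.choose_eq_zero_of_lt (by omega), zero_mul]

/-- `P` is the production matrix of the tree matrix `T`:
`t_{n+1,k} = Σ_{j=0}^n t_{n,j}·p_{j,k}` for all `n, k ≥ 0` (the left side
being `0` for `k > n+1`); moreover `p_{n,0} = p_{n,1} = n·S_n + 1`. -/
theorem prodEntry_is_production_matrix_of_treeEntry :
    (∀ n k : ℕ,
      treeEntry (n + 1) k = ∑ j ∈ Finset.range (n + 1), treeEntry n j * prodEntry j k) ∧
    (∀ n : ℕ, prodEntry n 0 = n * orderedSubsetNum n + 1 ∧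
      prodEntry n 1 = n * orderedSubsetNum n + 1) := by
  refine ⟨fun n k => ?_, fun n => ⟨by simp [prodEntry_eq], ?_⟩⟩
  · simp only [treeEntry_eq, prodEntry_eq, mul_add, Finset.sum_add_distrib]
    rw [sum_choose_mul_pow_mul_of_recurrence
        (q := fun j => j.choose k * orderedSubsetNum (j - k)) (c := fun j => j.choose k)
        (by simp [orderedSubsetNum_zero]) (choose_mul_orderedSubsetNum_succ k),
      sum_choose_mul_pow_mul_choose]
    cases k with
    | zero =>
      have h := sum_choose_mul_pow_mul_choose n n 0
      simp only [Nat.choose_zero_right, Nat.sub_zero] at h ⊢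
      rw [h]
      ring
    | succ k =>
      simp only [Nat.choose_succ_succ', mul_add, Finset.sum_add_distrib,
        sum_choose_mul_pow_mul_choose, Nat.add_sub_add_right]
      rcases lt_or_ge k n with hk | hk
      · obtain ⟨d, rfl⟩ := Nat.exists_eq_add_of_lt hk
        rw [show k + d + 1 - k = d + 1 by omega, show k + d + 1 - (k + 1) = d by omega]
        ring
      · simp [Nat.choose_eq_zero_of_lt (Nat.lt_succ_of_le hk)]
  · cases n with
    | zero => simp [prodEntry_eq]
    | succ n =>
      rw [prodEntry_eq, Nat.choose_one_right, Nat.choose_one_right, Nat.add_sub_cancel,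
        orderedSubsetNum_succ]
      ring
end
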